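/- Let d be a positive odd squarefree integer. Suppose that (i) the narrow class group of ℚ(√(2d)) has no elements of order 4, and (ii) (2/p) = 1 for all primes p dividing d. Then the equation x² − 2d·y² = 2 has a solution in integers x and y. -/

import Mathlib

open NumberField IntermediateField
open scoped nonZeroDivisors

/-- The subgroup of invertible fractional ideals generated by principal fractional ideals
with a totally positive generator. -/
def narrowPrincipals (F : Type*) [Field F] :
    Subgroup (FractionalIdeal (𝓞 F)⁰ F)ˣ :=
  Subgroup.closure {I | ∃ x : F, (∀ φ : F →+* ℝ, 0 < φ x) ∧
    ((I : FractionalIdeal (𝓞 F)⁰ F) : Submodule (𝓞 F) F) = Submodule.span (𝓞 F) {x}}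

/-- The narrow class group: nonzero fractional ideals modulo principal fractional ideals
generated by totally positive elements. -/
abbrev NarrowClassGroup (F : Type*) [Field F] :=
  (FractionalIdeal (𝓞 F)⁰ F)ˣ ⧸ narrowPrincipals F

/-- `ℚ(√n)` as a subfield of `ℂ`. -/
noncomputable def quadField (n : ℕ) : IntermediateField ℚ ℂ := ℚ⟮(Real.sqrt n : ℂ)⟯


lemma sq_mod (d : ℕ) (hpos : 0 < d) (hsf : Squarefree d)
    (hleg : ∀ p : ℕ, p.Prime → p ∣ d → jacobiSym 2 p = 1) : ∃ t : ℤ, (d : ℤ) ∣ t ^ 2 - 2 := by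
  induction d using Nat.recOnMul with
  | zero => omega
  | one => exact ⟨0, by simp⟩
  | prime p hp =>
    have h := hleg p hp dvd_rfl
    have : Fact p.Prime := ⟨hp⟩
    rw [← jacobiSym.legendreSym.to_jacobiSym, legendreSym.eq_one_iff] at h
    · obtain ⟨y, hy⟩ := h
      obtain ⟨t, rfl⟩ := ZMod.intCast_surjective y
      refine ⟨t, ?_⟩
      rw [← ZMod.intCast_zmod_eq_zero_iff_dvd]
      push_cast at hy ⊢
      rw [hy]; ring
    · intro h0
      have h2 : legendreSym p 2 = 0 := (legendreSym.eq_zero_iff p 2).2 (by exact_mod_cast h0)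
      rw [h] at h2
      exact one_ne_zero h2
  | mul a b iha ihb =>
    have ha : 0 < a := Nat.pos_of_mul_pos_right hpos
    have hb : 0 < b := Nat.pos_of_mul_pos_left hpos
    obtain ⟨hc, hsa, hsb⟩ := Nat.squarefree_mul_iff.1 hsf
    obtain ⟨t, ht⟩ := iha ha hsa (fun p hp h => hleg p hp (h.mul_right b))
    obtain ⟨s, hs⟩ := ihb hb hsb (fun p hp h => hleg p hp (h.mul_left a))
    have hc' : IsCoprime (a : ℤ) b := Nat.isCoprime_iff_coprime.2 hc
    obtain ⟨u, v, huv⟩ := hc'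
    refine ⟨t * (v * b) + s * (u * a), ?_⟩
    push_cast
    refine IsCoprime.mul_dvd (Nat.isCoprime_iff_coprime.2 hc) ?_ ?_
    · obtain ⟨k, hk⟩ := ht
      have : v * b = 1 - u * a := by linarith
      rw [this]
      refine ⟨k + (s*u - t * u) * (2 * t + (s*u - t * u) * a), ?_⟩
      linear_combination hk
    · obtain ⟨k, hk⟩ := hs
      have : u * a = 1 - v * b := by linarith
      rw [this]
      refine ⟨k + (t*v - s * v) * (2 * s + (t*v - s * v) * b), ?_⟩
      linear_combination hk

lemma no_sq_two (x y : ℤ) (h : x ^ 2 = 2 * y ^ 2) : y = 0 := by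
  by_contra hy
  have h2 : (x / y : ℚ) ^ 2 = 2 := by
    have : (x : ℚ) ^ 2 = 2 * y ^ 2 := by exact_mod_cast h
    have hy' : (y : ℚ) ≠ 0 := by exact_mod_cast hy
    field_simp; linarith
  have := irrational_sqrt_two
  apply this
  refine ⟨|(x / y : ℚ)|, ?_⟩
  have h3 : (((x / y : ℚ)) : ℝ) ^ 2 = 2 := by exact_mod_cast h2
  rw [← h3, Real.sqrt_sq_eq_abs, Rat.cast_abs]

lemma thue (d : ℕ) (hpos : 0 < d) (hsf : Squarefree d)
    (hleg : ∀ p : ℕ, p.Prime → p ∣ d → jacobiSym 2 p = 1) :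
    ∃ z w : ℤ, z ^ 2 = 2 * w ^ 2 - d := by
  rcases eq_or_ne d 1 with rfl | hd1
  · exact ⟨1, 1, by norm_num⟩
  obtain ⟨t, ht⟩ := sq_mod d hpos hsf hleg
  have : NeZero d := ⟨hpos.ne'⟩
  set s := Nat.sqrt d with hs
  have hlt : s * s < d := by
    refine lt_of_le_of_ne (Nat.sqrt_le d) fun h => ?_
    have h1 : IsUnit s := hsf s ⟨1, by omega⟩
    rw [Nat.isUnit_iff] at h1
    rw [h1] at h; omega
  have hlt2 : d < (s + 1) * (s + 1) := Nat.lt_succ_sqrt d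
  let f : ℕ × ℕ → ZMod d := fun p => (p.1 : ZMod d) - t * p.2
  obtain ⟨p, hp, q, hq, hne, hpq⟩ := Finset.exists_ne_map_eq_of_card_lt_of_maps_to
    (s := Finset.range (s+1) ×ˢ Finset.range (s+1)) (t := (Finset.univ : Finset (ZMod d))) (f := f)
    (by simpa [ZMod.card] using hlt2) (by intro x _; simp)
  simp only [Finset.mem_product, Finset.mem_range] at hp hq
  let x : ℤ := (p.1 : ℤ) - q.1
  let y : ℤ := (p.2 : ℤ) - q.2
  have hxy : (d : ℤ) ∣ x - t * y := by
    rw [← ZMod.intCast_zmod_eq_zero_iff_dvd]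
    simp only [x, y, f] at hpq ⊢
    push_cast
    linear_combination hpq
  have hdv : (d : ℤ) ∣ x ^ 2 - 2 * y ^ 2 := by
    have : x ^ 2 - 2 * y ^ 2 = (x - t * y) * (x + t * y) + (t ^ 2 - 2) * y ^ 2 := by ring
    rw [this]
    exact dvd_add (hxy.mul_right _) (ht.mul_right _)
  have hltz : (s : ℤ) * s < d := by exact_mod_cast hlt
  have hx2 : x ^ 2 < d := by
    have h1 : x ≤ s := by simp only [x]; omega
    have h2 : -(s:ℤ) ≤ x := by simp only [x]; omega
    nlinarith
  have hy2 : y ^ 2 < d := by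
    have h1 : y ≤ s := by simp only [y]; omega
    have h2 : -(s:ℤ) ≤ y := by simp only [y]; omega
    nlinarith
  obtain ⟨k, hk⟩ := hdv
  have hd0 : (0 : ℤ) < d := by exact_mod_cast hpos
  have hk1 : k < 1 := by nlinarith [sq_nonneg x, sq_nonneg y]
  have hk2 : -2 < k := by nlinarith [sq_nonneg x, sq_nonneg y]
  have : k = 0 ∨ k = -1 := by omega
  rcases this with rfl | rfl
  · exfalso
    have hy0 := no_sq_two x y (by linarith)
    have hx0 : x = 0 := by
      rw [hy0] at hk
      have : x ^ 2 = 0 := by linarith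
      exact pow_eq_zero_iff (two_ne_zero) |>.1 this
    apply hne
    simp only [x, y] at hx0 hy0
    ext <;> omega
  · exact ⟨x, y, by linarith⟩

lemma setup (d : ℕ) (hpos : 0 < d) (hodd : Odd d) (hsf : Squarefree d)
    (hleg : ∀ p : ℕ, p.Prime → p ∣ d → jacobiSym 2 p = 1) :
    ∃ z w : ℤ, z ^ 2 = 2 * w ^ 2 - d ∧ 0 < w ∧ z ≠ 0 ∧ IsCoprime (d * z) 2 ∧ IsCoprime z (8 * w) := by
  obtain ⟨z, w, h⟩ := thue d hpos hsf hleg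
  have hd : Odd (d : ℤ) := by exact_mod_cast hodd
  have hz : Odd z := by
    have : Odd (z ^ 2) := by
      rw [h]; exact Even.sub_odd (even_two_mul _) hd
    exact (Int.odd_pow' two_ne_zero).1 this
  have hw0 : w ≠ 0 := by
    rintro rfl
    have : (0:ℤ) < d := by exact_mod_cast hpos
    nlinarith
  have hzw : IsCoprime z w := by
    rw [Int.isCoprime_iff_gcd_eq_one]
    have h1 : ((Int.gcd z w : ℕ) : ℤ) * (Int.gcd z w) ∣ d := by
      have : (d : ℤ) = 2 * (w * w) - z * z := by linarith
      rw [this]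
      exact dvd_sub (Dvd.dvd.mul_left (mul_dvd_mul (Int.gcd_dvd_right ..) (Int.gcd_dvd_right ..)) _)
        (mul_dvd_mul (Int.gcd_dvd_left ..) (Int.gcd_dvd_left ..))
    exact Nat.isUnit_iff.1 (hsf _ (by exact_mod_cast h1))
  have h2 : IsCoprime z 2 := by
    exact Int.isCoprime_iff_gcd_eq_one.2 (by
      have := Int.gcd_comm z 2
      rw [this]; exact Int.isCoprime_iff_gcd_eq_one.1 (Int.isCoprime_two_left.2 hz) )
  have h8 : IsCoprime z 8 := by simpa using (IsCoprime.pow_right (n := 3) h2)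
  refine ⟨z, |w|, by rw [sq_abs]; exact h, abs_pos.2 hw0, ?_, ?_, ?_⟩
  · rintro rfl; simp at hz
  · refine IsCoprime.mul_left ?_ h2
    exact (Int.isCoprime_two_left.2 hd).symm
  · refine IsCoprime.mul_right h8 ?_
    rcases abs_choice w with h | h <;> rw [h]
    · exact hzw
    · exact hzw.neg_right

lemma P_sq {R : Type*} [CommRing R] (d : ℤ) (hd : Odd d) (r : R) (hr : r ^ 2 = 2 * d) :
    (Ideal.span {2, r}) ^ 2 = Ideal.span {(2 : R)} := by
  rw [sq, Ideal.span_pair_mul_span_pair]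
  apply le_antisymm
  · rw [Ideal.span_le]
    rintro x (rfl | rfl | rfl | rfl)
    · exact Ideal.mem_span_singleton.2 ⟨2, by ring⟩
    · exact Ideal.mem_span_singleton.2 ⟨r, by ring⟩
    · exact Ideal.mem_span_singleton.2 ⟨r, by ring⟩
    · exact Ideal.mem_span_singleton.2 ⟨d, by rw [← hr]; ring⟩
  · rw [Ideal.span_le, Set.singleton_subset_iff]
    obtain ⟨k, rfl⟩ := hd
    have h4 : (2 * 2 : R) ∈ Ideal.span {2 * 2, 2 * r, r * 2, r * r} := Ideal.subset_span (by simp)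
    have hrr : (r * r : R) ∈ Ideal.span {2 * 2, 2 * r, r * 2, r * r} := Ideal.subset_span (by simp)
    have : (2 : R) = r * r + (-k) * (2 * 2) := by
      push_cast at hr; linear_combination -hr
    have h5 := Ideal.add_mem _ hrr (Ideal.mul_mem_left _ (-k : R) h4)
    rw [← this] at h5
    exact h5

lemma J_sq {R : Type*} [CommRing R] (d z w : ℤ) (r : R) (hr : r ^ 2 = 2 * d)
    (h : z ^ 2 = 2 * w ^ 2 - d) (h1 : IsCoprime (d * z) 2) (h2 : IsCoprime z (8 * w)) :
    (Ideal.span {(z : R), 2 * w + r}) ^ 2 * Ideal.span {2, r} = Ideal.span {(2 * w + r : R)} := by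
  have hR : (z : R) ^ 2 = 2 * w ^ 2 - d := by exact_mod_cast congrArg (Int.cast : ℤ → R) h
  have hz : (z : R) ∈ Ideal.span {(z : R), 2 * w + r} := Ideal.subset_span (by simp)
  have ha : (2 * w + r : R) ∈ Ideal.span {(z : R), 2 * w + r} := Ideal.subset_span (by simp)
  have hp2 : (2 : R) ∈ Ideal.span {2, r} := Ideal.subset_span (by simp)
  have hpr : (r : R) ∈ Ideal.span {2, r} := Ideal.subset_span (by simp)
  apply le_antisymm
  · rw [sq, Ideal.span_pair_mul_span_pair, Ideal.span_mul_span', Ideal.span_le]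
    rintro x ⟨a, ha, b, hb, rfl⟩
    rw [SetLike.mem_coe, Ideal.mem_span_singleton]
    rcases ha with rfl | rfl | rfl | rfl <;> rcases hb with rfl | hb
    · exact ⟨2 * w - r, by linear_combination 2 * hR + hr⟩
    · exact ⟨w * r - d, by rw [Set.mem_singleton_iff.1 hb]; linear_combination r * hR - w * hr⟩
    · exact ⟨z * 2, by ring⟩
    · exact ⟨z * r, by rw [Set.mem_singleton_iff.1 hb]; ring⟩
    · exact ⟨z * 2, by ring⟩
    · exact ⟨z * r, by rw [Set.mem_singleton_iff.1 hb]; ring⟩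
    · exact ⟨(2 * w + r) * 2, by ring⟩
    · exact ⟨(2 * w + r) * r, by rw [Set.mem_singleton_iff.1 hb]; ring⟩
  · rw [Ideal.span_le, Set.singleton_subset_iff, SetLike.mem_coe, sq]
    set I := Ideal.span {(z : R), 2 * w + r} * Ideal.span {(z : R), 2 * w + r} * Ideal.span {2, r} with hI
    have e1 : ((z : R) * z) * 2 ∈ I := Ideal.mul_mem_mul (Ideal.mul_mem_mul hz hz) hp2
    have e2 : (z * z) * r ∈ I := Ideal.mul_mem_mul (Ideal.mul_mem_mul hz hz) hpr
    have e3 : (z * (2 * w + r)) * 2 ∈ I := Ideal.mul_mem_mul (Ideal.mul_mem_mul hz ha) hp2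
    have e5 : ((2 * w + r) * (2 * w + r)) * 2 ∈ I := Ideal.mul_mem_mul (Ideal.mul_mem_mul ha ha) hp2
    obtain ⟨u, v, huv⟩ := h1
    obtain ⟨u', v', huv'⟩ := h2
    have huv : (u : R) * (d * z) + v * 2 = 1 := by exact_mod_cast congrArg (Int.cast : ℤ → R) huv
    have huv' : (u' : R) * z + v' * (8 * w) = 1 := by exact_mod_cast congrArg (Int.cast : ℤ → R) huv'
    have f1 : (d * z * z) * (2 * w + r) ∈ I := by
      have : (d * z * z : R) * (2 * w + r) = (w * r + d) * (z * z * r) := by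
        linear_combination -w * z ^ 2 * hr
      rw [this]
      exact I.mul_mem_left _ e2
    have f2 : z * (2 * w + r) ∈ I := by
      have : z * (2 * w + r) = u * ((d * z * z) * (2 * w + r)) + v * ((z * (2 * w + r)) * 2) := by
        linear_combination -(z * (2 * w + r)) * huv
      rw [this]
      exact I.add_mem (I.mul_mem_left _ f1) (I.mul_mem_left _ e3)
    have f3 : (8 * w) * (2 * w + r) ∈ I := by
      have : (8 * w) * (2 * w + r) = ((2 * w + r) * (2 * w + r)) * 2 + 2 * ((z * z) * 2) := by
        linear_combination -4 * hR -2 * hr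
      rw [this]
      exact I.add_mem e5 (I.mul_mem_left _ e1)
    have : 2 * w + r = u' * (z * (2 * w + r)) + v' * ((8 * w) * (2 * w + r)) := by
      linear_combination -(2 * w + r) * huv'
    rw [this]
    exact I.add_mem (I.mul_mem_left _ f2) (I.mul_mem_left _ f3)

lemma mem_narrow {F : Type*} [Field F] [NumberField F] (I : (FractionalIdeal (𝓞 F)⁰ F)ˣ) :
    I ∈ narrowPrincipals F ↔ ∃ x : F, (∀ φ : F →+* ℝ, 0 < φ x) ∧
      (I : FractionalIdeal (𝓞 F)⁰ F) = FractionalIdeal.spanSingleton (𝓞 F)⁰ x := by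
  have key : ∀ (I : FractionalIdeal (𝓞 F)⁰ F) (x : F),
      (I : Submodule (𝓞 F) F) = Submodule.span (𝓞 F) {x} ↔
        I = FractionalIdeal.spanSingleton (𝓞 F)⁰ x := by
    intro I x
    rw [← FractionalIdeal.coe_spanSingleton (𝓞 F)⁰ x]
    exact FractionalIdeal.coeToSubmodule_inj
  constructor
  · intro h
    induction h using Subgroup.closure_induction with
    | mem I hI =>
      obtain ⟨x, hx, h⟩ := hI
      exact ⟨x, hx, (key _ _).1 h⟩
    | one => exact ⟨1, by simp, by simp⟩
    | mul I J _ _ hI hJ =>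
      obtain ⟨x, hx, h⟩ := hI
      obtain ⟨y, hy, h'⟩ := hJ
      refine ⟨x * y, fun φ => by rw [map_mul]; exact mul_pos (hx φ) (hy φ), ?_⟩
      rw [Units.val_mul, h, h', FractionalIdeal.spanSingleton_mul_spanSingleton]
    | inv I _ hI =>
      obtain ⟨x, hx, h⟩ := hI
      refine ⟨x⁻¹, fun φ => by rw [map_inv₀]; exact inv_pos.2 (hx φ), ?_⟩
      rw [Units.val_inv_eq_inv_val, h, FractionalIdeal.spanSingleton_inv]
  · rintro ⟨x, hx, h⟩
    exact Subgroup.subset_closure ⟨x, hx, (key _ _).2 h⟩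

lemma int_of_integral (q : ℚ) (h : IsIntegral ℤ (q : ℝ)) : ∃ m : ℤ, q = m := by
  have h1 : IsIntegral ℤ q := by
    have : IsIntegral ℤ (algebraMap ℚ ℝ q) := by simpa using h
    exact (isIntegral_algebraMap_iff (algebraMap ℚ ℝ).injective).1 this
  obtain ⟨m, hm⟩ := IsIntegrallyClosed.isIntegral_iff.1 h1
  exact ⟨m, by rw [← hm]; simp⟩

lemma int_coords (d : ℤ) (hodd : Odd d) (hsf : Squarefree d) (a b : ℚ) (A N : ℤ)
    (hA : 2 * a = A) (hN : a ^ 2 - 2 * d * b ^ 2 = N) : ∃ x y : ℤ, a = x ∧ b = y := by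
  have h1 : 2 * (d : ℚ) * (2 * b) ^ 2 = ((A ^ 2 - 4 * N : ℤ) : ℚ) := by
    push_cast; rw [← hA, ← hN]; ring
  have hsf2 : Squarefree (2 * d) := by
    rw [squarefree_mul_iff]
    refine ⟨?_, Int.prime_two.squarefree, hsf⟩
    exact (Int.isCoprime_two_left.2 hodd).isRelPrime
  obtain ⟨B, hB⟩ : ∃ B : ℤ, 2 * b = B := by
    set c := 2 * b with hc
    refine ⟨c.num, ?_⟩
    have h2 : (2 * d) * c.num ^ 2 = (A ^ 2 - 4 * N) * (c.den : ℤ) ^ 2 := by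
      have hd : (c.den : ℚ) ≠ 0 := by exact_mod_cast c.den_ne_zero
      have : (2 * (d : ℚ)) * c.num ^ 2 = ((A ^ 2 - 4 * N : ℤ) : ℚ) * (c.den : ℚ) ^ 2 := by
        rw [← h1]
        nth_rw 2 [← Rat.num_div_den c]
        field_simp
      exact_mod_cast this
    have hcop : IsCoprime ((c.den : ℤ) ^ 2) (c.num ^ 2) := by
      refine IsCoprime.pow ?_
      rw [Int.isCoprime_iff_gcd_eq_one, Int.gcd_comm]
      simpa [Int.gcd] using c.reduced
    have h3 : (c.den : ℤ) ^ 2 ∣ 2 * d := hcop.dvd_of_dvd_mul_right ⟨A ^ 2 - 4 * N, by linarith⟩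
    have h4 : IsUnit (c.den : ℤ) := hsf2 _ (by rwa [← sq])
    have h5 : c.den = 1 := by simpa using Int.isUnit_iff_natAbs_eq.1 h4
    exact (Rat.den_eq_one_iff c).1 h5 |>.symm
  have h2 : 2 * d * B ^ 2 = A ^ 2 - 4 * N := by
    rw [hB] at h1; exact_mod_cast h1
  have hAe : Even A := by
    have : Even (A ^ 2) := ⟨d * B ^ 2 + 2 * N, by linarith⟩
    exact (Int.even_pow' two_ne_zero).1 this
  obtain ⟨x, hx⟩ := hAe
  have hBe : Even B := by
    have : Even (d * B ^ 2) := ⟨x ^ 2 - N, by rw [hx] at h2; nlinarith⟩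
    rcases Int.even_mul.1 this with h | h
    · exact absurd h (Int.not_even_iff_odd.2 hodd)
    · exact (Int.even_pow' two_ne_zero).1 h
  obtain ⟨y, hy⟩ := hBe
  refine ⟨x, y, ?_, ?_⟩
  · rw [hx] at hA; push_cast at hA; linarith
  · rw [hy] at hB; push_cast at hB; linarith

lemma main_abs {F : Type*} [Field F] [NumberField F] (d : ℕ) (hpos : 0 < d) (hodd : Odd d)
    (hsf : Squarefree d) (h4 : ∀ g : NarrowClassGroup F, orderOf g ≠ 4)
    (hleg : ∀ p : ℕ, p.Prime → p ∣ d → jacobiSym 2 p = 1)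
    (r : F) (hr : r ^ 2 = 2 * d) (hgen : ∀ x : F, ∃ a b : ℚ, x = a + b * r)
    (σ τ : F →+* ℝ) (hστ : τ r = - σ r) :
    ∃ x y : ℤ, x ^ 2 - 2 * (d : ℤ) * y ^ 2 = 2 := by
  obtain ⟨z, w, hzw, hw, hz0, h1, h2⟩ := setup d hpos hodd hsf hleg
  have hri : IsIntegral ℤ r := by
    refine IsIntegral.of_pow (n := 2) (by norm_num) ?_
    rw [hr]
    exact_mod_cast isIntegral_algebraMap (R := ℤ) (A := F) (x := 2 * d)
  let R : 𝓞 F := ⟨r, hri⟩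
  have hRr : algebraMap (𝓞 F) F R = r := rfl
  have hR : R ^ 2 = 2 * ((d : ℤ) : 𝓞 F) := by
    apply RingOfIntegers.ext
    have e2 : algebraMap (𝓞 F) F 2 = 2 := map_ofNat _ 2
    change algebraMap (𝓞 F) F (R ^ 2) = algebraMap (𝓞 F) F (2 * ((d : ℤ) : 𝓞 F))
    rw [map_pow, map_mul, e2, hRr, hr, map_intCast, Int.cast_natCast]
  have hP := P_sq (d : ℤ) (by exact_mod_cast hodd) R hR
  have hJ := J_sq (d : ℤ) z w R hR hzw h1 h2
  set P : Ideal (𝓞 F) := Ideal.span {2, R} with hPdef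
  set J : Ideal (𝓞 F) := Ideal.span {(z : 𝓞 F), 2 * w + R} with hJdef
  have hJ0 : (J : FractionalIdeal (𝓞 F)⁰ F) ≠ 0 := by
    rw [FractionalIdeal.coeIdeal_ne_zero]
    intro h
    have : (z : 𝓞 F) ∈ J := Ideal.subset_span (by simp)
    rw [h, Ideal.mem_bot] at this
    exact hz0 (by exact_mod_cast this)
  let α : F := 2 * w + r
  have hJ' : (J : FractionalIdeal (𝓞 F)⁰ F) ^ 2 * (P : FractionalIdeal (𝓞 F)⁰ F) =
      FractionalIdeal.spanSingleton (𝓞 F)⁰ α := by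
    rw [← FractionalIdeal.coeIdeal_pow, ← FractionalIdeal.coeIdeal_mul, hJ,
      FractionalIdeal.coeIdeal_span_singleton]
    congr 1
  have hP' : (P : FractionalIdeal (𝓞 F)⁰ F) ^ 2 = FractionalIdeal.spanSingleton _ (2 : F) := by
    rw [← FractionalIdeal.coeIdeal_pow, hP, FractionalIdeal.coeIdeal_span_singleton]
    congr 1
  have two : ∀ φ : F →+* ℝ, φ 2 = 2 := fun φ => map_ofNat φ 2
  have hα : ∀ φ : F →+* ℝ, 0 < φ α := by
    intro φ
    have e : φ r ^ 2 = 2 * d := by rw [← map_pow, hr]; simp [two]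
    have e2 : φ α = 2 * w + φ r := by simp [α, two]
    have e3 : (z : ℝ) ^ 2 = 2 * w ^ 2 - d := by exact_mod_cast congrArg (Int.cast : ℤ → ℝ) hzw
    have e4 : (0 : ℝ) < w := by exact_mod_cast hw
    have e5 : (0 : ℝ) < z ^ 2 := by positivity
    rw [e2]
    have : |φ r| < 2 * w := abs_lt_of_sq_lt_sq (by nlinarith) (by positivity)
    linarith [neg_abs_le (φ r)]
  let Ju : (FractionalIdeal (𝓞 F)⁰ F)ˣ := Units.mk0 _ hJ0
  let g : NarrowClassGroup F := QuotientGroup.mk Ju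
  have h20 : FractionalIdeal.spanSingleton (𝓞 F)⁰ (2 : F) ≠ 0 := by
    rw [Ne, FractionalIdeal.spanSingleton_eq_zero_iff]; exact two_ne_zero
  have hg4 : g ^ 4 = 1 := by
    rw [← QuotientGroup.mk_pow, QuotientGroup.eq_one_iff, mem_narrow]
    refine ⟨α ^ 2 / 2, fun φ => by have := hα φ; rw [map_div₀, map_pow]; simp only [two]; positivity, ?_⟩
    apply mul_right_cancel₀ h20
    rw [FractionalIdeal.spanSingleton_mul_spanSingleton, div_mul_cancel₀ _ two_ne_zero,
      ← FractionalIdeal.spanSingleton_pow, ← hJ', ← hP']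
    simp only [Ju, Units.val_pow_eq_pow_val, Units.val_mk0]
    ring
  have hg2 : g ^ 2 = 1 := by
    have hdv : orderOf g ∣ 2 ^ 2 := orderOf_dvd_of_pow_eq_one hg4
    obtain ⟨k, hk, hk'⟩ := (Nat.dvd_prime_pow Nat.prime_two).1 hdv
    have := h4 g
    apply orderOf_dvd_iff_pow_eq_one.1
    interval_cases k
    · rw [hk']; norm_num
    · rw [hk']; norm_num
    · exact absurd hk' this
  rw [← QuotientGroup.mk_pow, QuotientGroup.eq_one_iff, mem_narrow] at hg2
  obtain ⟨γ, hγ, hJγ⟩ := hg2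
  have hγ0 : γ ≠ 0 := by
    rintro rfl
    simpa using hγ σ
  simp only [Ju, Units.val_pow_eq_pow_val, Units.val_mk0] at hJγ
  let β : F := α / γ
  have hβ : ∀ φ : F →+* ℝ, 0 < φ β := fun φ => by
    rw [map_div₀]; exact div_pos (hα φ) (hγ φ)
  have hPβ : (P : FractionalIdeal (𝓞 F)⁰ F) = FractionalIdeal.spanSingleton _ β := by
    have : FractionalIdeal.spanSingleton (𝓞 F)⁰ γ ≠ 0 := by
      rwa [Ne, FractionalIdeal.spanSingleton_eq_zero_iff]
    apply mul_left_cancel₀ this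
    rw [FractionalIdeal.spanSingleton_mul_spanSingleton, mul_div_cancel₀ _ hγ0, ← hJ', hJγ]
  have hβ2 : FractionalIdeal.spanSingleton (𝓞 F)⁰ (β ^ 2) = FractionalIdeal.spanSingleton _ 2 := by
    rw [← FractionalIdeal.spanSingleton_pow, ← hPβ, hP']
  obtain ⟨u, hu⟩ := (FractionalIdeal.mem_spanSingleton _).1
    (hβ2 ▸ FractionalIdeal.mem_spanSingleton_self (𝓞 F)⁰ (β ^ 2))
  obtain ⟨v, hv⟩ := (FractionalIdeal.mem_spanSingleton _).1
    (hβ2.symm ▸ FractionalIdeal.mem_spanSingleton_self (𝓞 F)⁰ (2 : F))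
  have hβP : β ∈ (P : FractionalIdeal (𝓞 F)⁰ F) := hPβ ▸ FractionalIdeal.mem_spanSingleton_self _ β
  obtain ⟨b, -, hb⟩ := (FractionalIdeal.mem_coeIdeal _).1 hβP
  have hσr : σ r ^ 2 = 2 * d := by rw [← map_pow, hr]; simp [two]
  have coords : ∀ t : 𝓞 F, ∃ x y : ℤ, σ t * τ t = ((x ^ 2 - 2 * d * y ^ 2 : ℤ) : ℝ) := by
    intro t
    obtain ⟨p, q, hpq⟩ := hgen t
    have es : σ t = p + q * σ r := by rw [hpq]; simp
    have et : τ t = p - q * σ r := by rw [hpq, map_add, map_mul, map_ratCast, map_ratCast, hστ]; ring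
    have is : IsIntegral ℤ (σ t) := (RingOfIntegers.isIntegral_coe t).map σ.toIntAlgHom
    have it : IsIntegral ℤ (τ t) := (RingOfIntegers.isIntegral_coe t).map τ.toIntAlgHom
    obtain ⟨A, hA⟩ := int_of_integral (2 * p) (by
      have := is.add it
      rw [es, et] at this
      have e : ((2 * p : ℚ) : ℝ) = (p + q * σ r) + (p - q * σ r) := by push_cast; ring
      rw [e]; exact this)
    have hN' : σ t * τ t = ((p ^ 2 - 2 * d * q ^ 2 : ℚ) : ℝ) := by
      rw [es, et]; push_cast; linear_combination - (q : ℝ) ^ 2 * hσr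
    obtain ⟨N, hN⟩ := int_of_integral (p ^ 2 - 2 * d * q ^ 2) (by
      rw [← hN']; exact is.mul it)
    obtain ⟨x, y, hx, hy⟩ := int_coords d (by exact_mod_cast hodd)
      (Int.squarefree_natCast.2 hsf) p q A N hA (by exact_mod_cast hN)
    refine ⟨x, y, ?_⟩
    rw [hN', hx, hy]; push_cast; ring
  obtain ⟨x, y, hxy⟩ := coords b
  obtain ⟨x1, y1, hu'⟩ := coords u
  obtain ⟨x2, y2, hv'⟩ := coords v
  set Nb := x ^ 2 - 2 * (d : ℤ) * y ^ 2 with hNb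
  set Nu := x1 ^ 2 - 2 * (d : ℤ) * y1 ^ 2
  set Nv := x2 ^ 2 - 2 * (d : ℤ) * y2 ^ 2
  have hb' : (b : F) = β := hb
  rw [hb'] at hxy
  have hNpos : 0 < Nb := by
    have := mul_pos (hβ σ) (hβ τ)
    rw [hxy] at this
    exact_mod_cast this
  rw [Algebra.smul_def] at hu hv
  have k1 : Nu * 4 = Nb ^ 2 := by
    have : (Nu : ℝ) * 4 = Nb ^ 2 := by
      rw [← hu', ← hxy, mul_pow, ← map_pow, ← map_pow, ← hu, map_mul, map_mul]
      simp only [two]; ring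
    exact_mod_cast this
  have k2 : Nv * Nb ^ 2 = 4 := by
    have : (Nv : ℝ) * Nb ^ 2 = 4 := by
      have e1 : (σ v * σ β ^ 2) = 2 := by rw [← map_pow, ← map_mul]; erw [hv]; exact two _
      have e2 : (τ v * τ β ^ 2) = 2 := by rw [← map_pow, ← map_mul]; erw [hv]; exact two _
      rw [← hv', ← hxy]
      linear_combination (τ v * τ β ^ 2) * e1 + 2 * e2
    exact_mod_cast this
  refine ⟨x, y, ?_⟩
  have k3 : Nb ≤ 2 := by
    by_contra h
    have : 0 < Nv := by
      by_contra hh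
      nlinarith [sq_nonneg Nb]
    nlinarith
  have k4 : Nb ≠ 1 := by
    intro h; rw [h] at k1; omega
  rw [← hNb]; omega

theorem stmt3 (d : ℕ) (hpos : 0 < d) (hodd : Odd d) (hsf : Squarefree d)
    (h4 : ∀ g : NarrowClassGroup (quadField (2 * d)), orderOf g ≠ 4)
    (hleg : ∀ p : ℕ, p.Prime → p ∣ d → jacobiSym 2 p = 1) :
    ∃ x y : ℤ, x ^ 2 - 2 * (d : ℤ) * y ^ 2 = 2 := by
  set s : ℂ := (Real.sqrt (2 * d : ℕ) : ℂ) with hs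
  have hs2 : s ^ 2 = 2 * d := by
    rw [hs, ← Complex.ofReal_pow, Real.sq_sqrt (by positivity)]; push_cast; rfl
  have hint : IsIntegral ℚ s := by
    refine IsIntegral.of_pow (n := 2) (by norm_num) ?_
    rw [hs2]
    exact_mod_cast isIntegral_algebraMap (R := ℚ) (A := ℂ) (x := 2 * d)
  have hnsq : ¬ IsSquare (2 * d) := by
    rintro ⟨k, hk⟩
    have : Even (k * k) := ⟨d, by omega⟩
    have hke : Even k := by rcases Nat.even_mul.1 this with h | h <;> exact h
    obtain ⟨m, rfl⟩ := hke
    obtain ⟨e, rfl⟩ := hodd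
    ring_nf at hk; omega
  have hirr : Irrational (Real.sqrt (2 * d : ℕ)) := irrational_sqrt_natCast_iff.2 hnsq
  have hmin : minpoly ℚ s = Polynomial.X ^ 2 - Polynomial.C (2 * d : ℚ) := by
    symm
    apply minpoly.eq_of_irreducible_of_monic
    · apply X_pow_sub_C_irreducible_of_prime Nat.prime_two
      intro q hq
      apply hirr
      refine ⟨|q|, ?_⟩
      have h3 : (q : ℝ) ^ 2 = (2 * d : ℕ) := by push_cast; exact_mod_cast hq
      rw [← h3, Real.sqrt_sq_eq_abs, Rat.cast_abs]
    · simp [hs2]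
    · exact Polynomial.monic_X_pow_sub_C _ two_ne_zero
  let pb : PowerBasis ℚ (quadField (2 * d)) := IntermediateField.adjoin.powerBasis hint
  have hfin : FiniteDimensional ℚ (quadField (2 * d)) := pb.finite
  have hnf : NumberField (quadField (2 * d)) := { }
  have hgenmin : minpoly ℚ pb.gen = Polynomial.X ^ 2 - Polynomial.C (2 * d : ℚ) := by
    rw [← hmin]
    exact IntermediateField.minpoly_gen ℚ s
  have hcoe : ((pb.gen : quadField (2 * d)) : ℂ) = s := IntermediateField.AdjoinSimple.coe_gen ℚ s
  have hr : pb.gen ^ 2 = 2 * d := by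
    apply Subtype.ext
    push_cast
    rw [hcoe, hs2]
    rfl
  have hsq : (Real.sqrt (2 * d : ℕ)) ^ 2 = 2 * d := by
    rw [Real.sq_sqrt (by positivity)]; push_cast; rfl
  let σ := pb.lift (Real.sqrt (2 * d : ℕ)) (by
    rw [hgenmin, map_sub, map_pow, Polynomial.aeval_X, Polynomial.aeval_C]
    simp only [neg_sq, hsq]
    simp)
  let τ := pb.lift (-Real.sqrt (2 * d : ℕ)) (by
    rw [hgenmin, map_sub, map_pow, Polynomial.aeval_X, Polynomial.aeval_C]
    simp only [neg_sq, hsq]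
    simp)
  refine main_abs d hpos hodd hsf h4 hleg pb.gen hr ?_ σ.toRingHom τ.toRingHom ?_
  · intro x
    have hx : x ∈ Algebra.adjoin ℚ {pb.gen} := by rw [pb.adjoin_gen_eq_top]; trivial
    induction hx using Algebra.adjoin_induction with
    | mem y hy =>
      rw [Set.mem_singleton_iff] at hy
      exact ⟨0, 1, by simp [hy]⟩
    | algebraMap q => exact ⟨q, 0, by simp⟩
    | add a b _ _ ha hb =>
      obtain ⟨a1, a2, ha⟩ := ha
      obtain ⟨b1, b2, hb⟩ := hb
      exact ⟨a1 + b1, a2 + b2, by rw [ha, hb]; push_cast; ring⟩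
    | mul a b _ _ ha hb =>
      obtain ⟨a1, a2, ha⟩ := ha
      obtain ⟨b1, b2, hb⟩ := hb
      refine ⟨a1 * b1 + 2 * d * (a2 * b2), a1 * b2 + a2 * b1, ?_⟩
      rw [ha, hb]; push_cast
      linear_combination (a2 * b2 : quadField (2 * d)) * hr
  · have e1 : σ pb.gen = Real.sqrt (2 * d : ℕ) := pb.lift_gen _ _
    have e2 : τ pb.gen = -Real.sqrt (2 * d : ℕ) := pb.lift_gen _ _
    change τ pb.gen = - σ pb.gen
    rw [e1, e2]
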